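/- Under the hypotheses of the previous covering lemma (M a finite monomial set of size D, p and q the coordinate-degree sums, I ⊆ [0,N] closed, f ∈ C^{D−1}(I) with |f^{(i)}(x)/i!| ≤ X δ^i for 0 ≤ i < D, X > 0, δ ≥ 1/N), the integer points {(x, f(x)) : x ∈ I} ∩ ℤ² are contained in a union of at most 4·δ·|I|·((2N)^p·(D·X)^q)^{1/binom(D,2)} + 1 zero sets of nonzero polynomials supported on M. -/

import Mathlib

open Set Finset Real

/-- Iterated form of Rolle's theorem. -/
theorem exists_iteratedDerivWithin_eq_zero {a b : ℝ} (hab : a < b) (k : ℕ) (h : ℝ → ℝ)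
    (hh : ContDiffOn ℝ k h (Icc a b)) (T : Finset ℝ) (hT : ∀ x ∈ T, x ∈ Icc a b)
    (hcard : T.card = k + 1) (hzero : ∀ x ∈ T, h x = 0) :
    ∃ ξ ∈ Icc a b, iteratedDerivWithin k h (Icc a b) ξ = 0 := by
  induction k generalizing h T with
  | zero =>
    obtain ⟨x, hx⟩ := Finset.card_pos.mp (by omega : 0 < T.card)
    exact ⟨x, hT x hx, by simpa using hzero x hx⟩
  | succ k ih =>
    have hd : ContDiffOn ℝ k (derivWithin h (Icc a b)) (Icc a b) :=
      hh.derivWithin (uniqueDiffOn_Icc hab) (by norm_cast)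
    set e := T.orderEmbOfFin hcard
    have hmem : ∀ i, e i ∈ T := fun i => T.orderEmbOfFin_mem hcard i
    have key : ∀ i : Fin (k + 1), ∃ c ∈ Ioo (e i.castSucc) (e i.succ),
        derivWithin h (Icc a b) c = 0 := by
      intro i
      have hsub : Icc (e i.castSucc) (e i.succ) ⊆ Icc a b :=
        Icc_subset_Icc (hT _ (hmem _)).1 (hT _ (hmem _)).2
      obtain ⟨c, hc, hc0⟩ := exists_deriv_eq_zero (f := h)
        (e.strictMono (Fin.castSucc_lt_succ (i := i))) (hh.continuousOn.mono hsub)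
        (by rw [hzero _ (hmem _), hzero _ (hmem _)])
      refine ⟨c, hc, ?_⟩
      rw [derivWithin_of_mem_nhds, hc0]
      exact Icc_mem_nhds ((hT _ (hmem _)).1.trans_lt hc.1) (hc.2.trans_le (hT _ (hmem _)).2)
    choose c hc hc0 using key
    have hmono : StrictMono c := by
      rw [Fin.strictMono_iff_lt_succ]
      intro i
      have h1 := (hc i.castSucc).2
      have h2 := (hc i.succ).1
      rw [Fin.succ_castSucc] at h1
      exact h1.trans h2
    obtain ⟨ξ, hξ, h0⟩ := ih (derivWithin h (Icc a b)) hd (Finset.univ.image c)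
      (by
        intro x hx
        obtain ⟨i, -, rfl⟩ := Finset.mem_image.mp hx
        exact ⟨(hT _ (hmem _)).1.trans (hc i).1.le, (hc i).2.le.trans (hT _ (hmem _)).2⟩)
      (by rw [Finset.card_image_of_injective _ hmono.injective]; simp)
      (by
        intro x hx
        obtain ⟨i, -, rfl⟩ := Finset.mem_image.mp hx
        exact hc0 i)
    exact ⟨ξ, hξ, by rw [iteratedDerivWithin_succ']; exact h0⟩

theorem Polynomial.iteratedDerivWithin_eval (s : Set ℝ) (hs : UniqueDiffOn ℝ s)
    (P : Polynomial ℝ) (k : ℕ) {x : ℝ} (hx : x ∈ s) :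
    iteratedDerivWithin k (fun t => P.eval t) s x = (Polynomial.derivative^[k] P).eval x := by
  induction k generalizing P with
  | zero => simp
  | succ k ih =>
    rw [iteratedDerivWithin_succ', Function.iterate_succ_apply, ← ih]
    refine iteratedDerivWithin_congr (fun y hy => ?_) hx
    exact P.derivWithin (hs y hy)

/-- Coefficients of `g` in the Newton basis attached to the nodes `x 0, x 1, …`. -/
theorem exists_newton_coeff (x : ℕ → ℝ) (g : ℝ → ℝ) (n : ℕ)
    (hx : Set.InjOn x (Set.Iio n)) :
    ∃ A : ℕ → ℝ, ∀ i < n,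
      g (x i) = ∑ k ∈ range (i + 1), A k * ∏ m ∈ range k, (x i - x m) := by
  induction n with
  | zero => exact ⟨0, by simp⟩
  | succ n ih =>
    obtain ⟨A, hA⟩ := ih (hx.mono (Set.Iio_subset_Iio (Nat.le_succ n)))
    have hne : ∏ m ∈ range n, (x n - x m) ≠ 0 := by
      refine Finset.prod_ne_zero_iff.mpr fun m hm => sub_ne_zero.mpr fun h => ?_
      have hm' := Finset.mem_range.mp hm
      have := hx (Set.mem_Iio.mpr (Nat.lt_succ_self n)) (Set.mem_Iio.mpr (by omega)) h
      omega
    refine ⟨Function.update A n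
      ((g (x n) - ∑ k ∈ range n, A k * ∏ m ∈ range k, (x n - x m)) /
        ∏ m ∈ range n, (x n - x m)), fun i hi => ?_⟩
    rcases Nat.lt_succ_iff_lt_or_eq.mp hi with h | rfl
    · rw [hA i h]
      refine Finset.sum_congr rfl fun k hk => ?_
      rw [Function.update_of_ne]
      have := Finset.mem_range.mp hk
      omega
    · rw [Finset.sum_range_succ, Function.update_self, div_mul_cancel₀ _ hne]
      rw [Finset.sum_congr rfl fun k hk => by
        rw [Function.update_of_ne (Finset.mem_range.mp hk).ne]]
      ring

/-- Mean value theorem for divided differences: Newton coefficients are values of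
`g⁽ᵏ⁾ / k!`. -/
theorem exists_newton_coeff_eq_iteratedDerivWithin {a b : ℝ} (hab : a < b) (x : ℕ → ℝ)
    (g : ℝ → ℝ) (A : ℕ → ℝ) (k : ℕ) (hg : ContDiffOn ℝ k g (Icc a b))
    (hx : Set.InjOn x (Set.Iio (k + 1))) (hmem : ∀ i < k + 1, x i ∈ Icc a b)
    (hA : ∀ i < k + 1, g (x i) = ∑ l ∈ range (i + 1), A l * ∏ m ∈ range l, (x i - x m)) :
    ∃ ξ ∈ Icc a b, A k = iteratedDerivWithin k g (Icc a b) ξ / (k.factorial : ℝ) := by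
  set B : ℕ → Polynomial ℝ := fun l => ∏ m ∈ range l, (Polynomial.X - Polynomial.C (x m)) with hB
  have hBmonic : ∀ l, (B l).Monic := fun l =>
    Polynomial.monic_prod_of_monic _ _ fun m _ => Polynomial.monic_X_sub_C _
  have hBdeg : ∀ l, (B l).natDegree = l := fun l => by
    rw [hB, Polynomial.natDegree_prod_of_monic _ _ fun m _ => Polynomial.monic_X_sub_C _]
    simp
  set P : Polynomial ℝ := ∑ l ∈ range (k + 1), Polynomial.C (A l) * B l with hP
  have hPeval : ∀ i < k + 1, P.eval (x i) = g (x i) := by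
    intro i hi
    rw [hA i hi, hP, Polynomial.eval_finsetSum]
    symm
    simp only [hB, Polynomial.eval_mul, Polynomial.eval_C, Polynomial.eval_prod,
      Polynomial.eval_sub, Polynomial.eval_X]
    refine Finset.sum_subset (Finset.range_subset_range.mpr (by omega)) fun l _ hl => ?_
    rw [Finset.prod_eq_zero (i := i), mul_zero]
    · simp only [Finset.mem_range] at hl ⊢; omega
    · simp
  have hPdeg : P.natDegree ≤ k := by
    refine Polynomial.natDegree_sum_le_of_forall_le _ _ fun l hl => ?_
    refine (Polynomial.natDegree_C_mul_le _ _).trans ?_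
    rw [hBdeg]
    exact Nat.lt_succ_iff.mp (Finset.mem_range.mp hl)
  have hPcoeff : P.coeff k = A k := by
    rw [hP, Polynomial.finsetSum_coeff, Finset.sum_range_succ, Finset.sum_eq_zero, zero_add,
      Polynomial.coeff_C_mul]
    · have := (hBmonic k).coeff_natDegree
      rw [hBdeg] at this
      rw [this, mul_one]
    · intro l hl
      rw [Polynomial.coeff_C_mul, Polynomial.coeff_eq_zero_of_natDegree_lt, mul_zero]
      rw [hBdeg]
      exact Finset.mem_range.mp hl
  have hPder : Polynomial.derivative^[k] P = Polynomial.C ((k.factorial : ℝ) * A k) := by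
    rw [Polynomial.eq_C_of_natDegree_le_zero (p := Polynomial.derivative^[k] P)
      ((Polynomial.natDegree_iterate_derivative P k).trans (by omega)),
      Polynomial.coeff_iterate_derivative]
    simp [hPcoeff, Nat.descFactorial_self]
  have hPsmooth : ContDiffOn ℝ k (fun t => P.eval t) (Icc a b) :=
    (by simpa using P.contDiff_aeval (𝕜 := ℝ) k : ContDiff ℝ k fun t => P.eval t).contDiffOn
  obtain ⟨ξ, hξ, h0⟩ := exists_iteratedDerivWithin_eq_zero hab k (g - fun t => P.eval t)
    (hg.sub hPsmooth) ((range (k + 1)).image x)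
    (by
      intro y hy
      obtain ⟨i, hi, rfl⟩ := Finset.mem_image.mp hy
      exact hmem i (Finset.mem_range.mp hi))
    (by
      rw [Finset.card_image_of_injOn, Finset.card_range]
      simpa [Set.Iio] using hx)
    (by
      intro y hy
      obtain ⟨i, hi, rfl⟩ := Finset.mem_image.mp hy
      simp [hPeval i (Finset.mem_range.mp hi)])
  refine ⟨ξ, hξ, ?_⟩
  rw [iteratedDerivWithin_sub hξ (uniqueDiffOn_Icc hab) (hg ξ hξ) (hPsmooth ξ hξ),
    P.iteratedDerivWithin_eval _ (uniqueDiffOn_Icc hab) k hξ, hPder, Polynomial.eval_C,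
    sub_eq_zero] at h0
  rw [h0, mul_div_cancel_left₀]
  positivity

/-- Determinant form of the generalized mean value theorem: if `g j` has Taylor coefficients
bounded by `C j * δ ^ k`, then the alternant at nodes of diameter at most `ℓ` is small. -/
theorem abs_det_le_of_iteratedDerivWithin_le {a b : ℝ} (hab : a < b) {n : ℕ} (x : Fin n → ℝ)
    (hx : Function.Injective x) (hmem : ∀ i, x i ∈ Icc a b) (ℓ : ℝ)
    (hℓ : ∀ i j, |x i - x j| ≤ ℓ) (g : Fin n → ℝ → ℝ)
    (hg : ∀ j, ContDiffOn ℝ (n - 1 : ℕ) (g j) (Icc a b)) (C : Fin n → ℝ) (δ : ℝ)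
    (hbound : ∀ j, ∀ k < n, ∀ t ∈ Icc a b,
      |iteratedDerivWithin k (g j) (Icc a b) t / (k.factorial : ℝ)| ≤ C j * δ ^ k) :
    |(Matrix.of fun i j => g j (x i)).det| ≤
      n.factorial * (δ * ℓ) ^ (n.choose 2) * ∏ j, C j := by
  set y : ℕ → ℝ := fun i => if h : i < n then x ⟨i, h⟩ else 0 with hy
  have hyx : ∀ i : Fin n, y i = x i := fun i => by simp [hy]
  have hyinj : Set.InjOn y (Set.Iio n) := by
    intro i hi j hj hij
    have := hx ((hyx ⟨i, hi⟩).symm.trans (hij.trans (hyx ⟨j, hj⟩)))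
    exact congrArg Fin.val this
  choose A hA using fun j => exists_newton_coeff y (g j) n hyinj
  have hAbound : ∀ j, ∀ k : Fin n, |A j k| ≤ C j * δ ^ (k : ℕ) := by
    intro j k
    obtain ⟨ξ, hξ, h⟩ := exists_newton_coeff_eq_iteratedDerivWithin hab y (g j) (A j) k
      ((hg j).of_le (by have := k.2; norm_cast; omega))
      (hyinj.mono (Set.Iio_subset_Iio k.2))
      (fun i hi => by
        have := hmem ⟨i, by omega⟩
        rwa [← hyx] at this)
      (fun i hi => hA j i (by omega))
    rw [h]
    exact hbound j k k.2 ξ hξ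
  set L : Matrix (Fin n) (Fin n) ℝ :=
    Matrix.of fun i k => ∏ m ∈ range (k : ℕ), (y i - y m) with hL
  set U : Matrix (Fin n) (Fin n) ℝ := Matrix.of fun k j => A j k with hU
  have hfac : (Matrix.of fun i j => g j (x i)) = L * U := by
    ext i j
    rw [Matrix.mul_apply, Matrix.of_apply, ← hyx, hA j i i.2]
    simp only [hL, hU, Matrix.of_apply]
    rw [Fin.sum_univ_eq_sum_range (fun k => (∏ m ∈ range k, (y i - y m)) * A j k) n]
    rw [← Finset.sum_subset (Finset.range_subset_range.mpr (by omega : (i : ℕ) + 1 ≤ n))]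
    · exact Finset.sum_congr rfl fun _ _ => mul_comm _ _
    · intro l _ hl
      rw [Finset.prod_eq_zero (i := (i : ℕ)), zero_mul]
      · simp only [Finset.mem_range] at hl ⊢; omega
      · simp
  have hLdet : |L.det| ≤ ℓ ^ (n.choose 2) := by
    rw [Matrix.det_of_isLowerTriangular L, Finset.abs_prod]
    · calc ∏ i : Fin n, |L i i| ≤ ∏ i : Fin n, ℓ ^ (i : ℕ) := by
            refine Finset.prod_le_prod (fun _ _ => abs_nonneg _) fun i _ => ?_
            rw [hL, Matrix.of_apply, Finset.abs_prod]
            calc ∏ m ∈ range (i : ℕ), |y i - y m| ≤ ∏ m ∈ range (i : ℕ), ℓ := by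
                  refine Finset.prod_le_prod (fun _ _ => abs_nonneg _) fun m hm => ?_
                  have := hℓ i ⟨m, (Finset.mem_range.mp hm).trans i.2⟩
                  rwa [← hyx, ← hyx] at this
              _ = ℓ ^ (i : ℕ) := by simp
        _ = ℓ ^ (n.choose 2) := by
            rw [Finset.prod_pow_eq_pow_sum, Fin.sum_univ_eq_sum_range (fun i => i) n,
              Finset.sum_range_id, Nat.choose_two_right]
    · intro i j hij
      rw [hL, Matrix.of_apply]
      refine Finset.prod_eq_zero (i := (i : ℕ)) ?_ (by simp)
      exact Finset.mem_range.mpr hij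
  have hUdet : |U.det| ≤ n.factorial * (δ ^ (n.choose 2) * ∏ j, C j) := by
    rw [Matrix.det_apply]
    refine (Finset.abs_sum_le_sum_abs _ _).trans ?_
    have hterm : ∀ σ ∈ (Finset.univ : Finset (Equiv.Perm (Fin n))),
        |Equiv.Perm.sign σ • ∏ i, U (σ i) i| ≤ δ ^ (n.choose 2) * ∏ j, C j := by
      intro σ _
      have h1 : |Equiv.Perm.sign σ • ∏ i, U (σ i) i| = ∏ i, |U (σ i) i| := by
        rcases Int.units_eq_one_or (Equiv.Perm.sign σ) with h | h <;>
          simp [h, Finset.abs_prod]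
      rw [h1]
      calc ∏ i, |U (σ i) i| ≤ ∏ i, (C i * δ ^ ((σ i : Fin n) : ℕ)) :=
            Finset.prod_le_prod (fun _ _ => abs_nonneg _) fun i _ => hAbound i (σ i)
        _ = δ ^ (n.choose 2) * ∏ j, C j := by
            rw [Finset.prod_mul_distrib, Equiv.prod_comp σ (fun i : Fin n => δ ^ (i : ℕ)),
              Finset.prod_pow_eq_pow_sum, Fin.sum_univ_eq_sum_range (fun i => i) n,
              Finset.sum_range_id, Nat.choose_two_right, mul_comm]
    refine (Finset.sum_le_card_nsmul _ _ _ hterm).trans (le_of_eq ?_)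
    rw [Finset.card_univ, Fintype.card_perm, Fintype.card_fin, nsmul_eq_mul]
  rw [hfac, Matrix.det_mul, abs_mul]
  calc |L.det| * |U.det| ≤ ℓ ^ (n.choose 2) * (n.factorial * (δ ^ (n.choose 2) * ∏ j, C j)) :=
        mul_le_mul hLdet hUdet (abs_nonneg _) ((abs_nonneg _).trans hLdet)
    _ = _ := by rw [mul_pow]; ring

/-- Weighted sum `∑_{k<n} |g⁽ᵏ⁾(t)| / k! · δ⁻ᵏ` of the Taylor coefficients of `g` at `t`. -/
noncomputable def taylorWeight (s : Set ℝ) (n : ℕ) (δ : ℝ) (g : ℝ → ℝ) (t : ℝ) : ℝ :=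
  ∑ k ∈ range n, |iteratedDerivWithin k g s t / (k.factorial : ℝ)| / δ ^ k

theorem taylorWeight_nonneg (s : Set ℝ) (n : ℕ) {δ : ℝ} (hδ : 0 < δ) (g : ℝ → ℝ) (t : ℝ) :
    0 ≤ taylorWeight s n δ g t :=
  Finset.sum_nonneg fun _ _ => by positivity

theorem sum_range_cauchyProduct_le (n : ℕ) (u v : ℕ → ℝ) (hu : ∀ i, 0 ≤ u i)
    (hv : ∀ i, 0 ≤ v i) :
    ∑ k ∈ range n, ∑ i ∈ range (k + 1), u i * v (k - i) ≤
      (∑ i ∈ range n, u i) * ∑ j ∈ range n, v j := by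
  rw [Finset.sum_range_diag_flip n fun i j => u i * v j, Finset.sum_mul_sum]
  exact Finset.sum_le_sum fun i _ => Finset.sum_le_sum_of_subset_of_nonneg
    (Finset.range_subset_range.mpr (Nat.sub_le n i)) fun j _ _ => mul_nonneg (hu i) (hv j)

theorem taylorWeight_mul_le {s : Set ℝ} (hs : UniqueDiffOn ℝ s) {n : ℕ} {δ : ℝ} (hδ : 0 < δ)
    {f g : ℝ → ℝ} (hf : ContDiffOn ℝ (n - 1 : ℕ) f s) (hg : ContDiffOn ℝ (n - 1 : ℕ) g s)
    {t : ℝ} (ht : t ∈ s) :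
    taylorWeight s n δ (f * g) t ≤ taylorWeight s n δ f t * taylorWeight s n δ g t := by
  refine le_trans ?_ (sum_range_cauchyProduct_le n
    (fun k => |iteratedDerivWithin k f s t / (k.factorial : ℝ)| / δ ^ k)
    (fun k => |iteratedDerivWithin k g s t / (k.factorial : ℝ)| / δ ^ k)
    (fun _ => by positivity) (fun _ => by positivity))
  refine Finset.sum_le_sum fun k hk => ?_
  have hk' : k ≤ n - 1 := by have := Finset.mem_range.mp hk; omega
  rw [iteratedDerivWithin_mul ht hs ((hf t ht).of_le (by exact_mod_cast hk'))
    ((hg t ht).of_le (by exact_mod_cast hk')), Finset.sum_div,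
    div_le_iff₀ (by positivity), Finset.sum_mul]
  refine (Finset.abs_sum_le_sum_abs _ _).trans (Finset.sum_le_sum fun i hi => le_of_eq ?_)
  have hik : i ≤ k := Nat.lt_succ_iff.mp (Finset.mem_range.mp hi)
  have hpow : δ ^ k = δ ^ i * δ ^ (k - i) := by rw [← pow_add]; congr 1; omega
  have hch : (k.choose i : ℝ) = k.factorial / (i.factorial * (k - i).factorial) :=
    Nat.cast_choose ℝ hik
  rw [hpow, hch]
  have e : (k.factorial : ℝ) / (i.factorial * (k - i).factorial) * iteratedDerivWithin i f s t *
      iteratedDerivWithin (k - i) g s t / k.factorial =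
      (iteratedDerivWithin i f s t / i.factorial) *
        (iteratedDerivWithin (k - i) g s t / (k - i).factorial) := by
    have := Nat.cast_ne_zero (R := ℝ).mpr (Nat.factorial_ne_zero k)
    field_simp
  rw [e, abs_mul]
  field_simp

theorem taylorWeight_one_le {s : Set ℝ} {n : ℕ} {δ : ℝ} (t : ℝ) :
    taylorWeight s n δ 1 t ≤ 1 := by
  unfold taylorWeight
  rcases n with _ | n
  · simp
  · rw [Finset.sum_range_succ', Finset.sum_eq_zero]
    · simp
    · intro k _
      have : iteratedDerivWithin (k + 1) (1 : ℝ → ℝ) s t = 0 := by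
        have := iteratedDerivWithin_const (𝕜 := ℝ) (n := k + 1) (c := (1 : ℝ)) (s := s) (x := t)
        rw [if_neg k.succ_ne_zero] at this
        exact this
      simp [this]

theorem taylorWeight_pow_le {s : Set ℝ} (hs : UniqueDiffOn ℝ s) {n : ℕ} {δ : ℝ} (hδ : 0 < δ)
    {f : ℝ → ℝ} (hf : ContDiffOn ℝ (n - 1 : ℕ) f s) {t : ℝ} (ht : t ∈ s) (m : ℕ) :
    taylorWeight s n δ (f ^ m) t ≤ taylorWeight s n δ f t ^ m := by
  induction m with
  | zero => simpa using taylorWeight_one_le t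
  | succ m ih =>
    rw [pow_succ, pow_succ]
    exact (taylorWeight_mul_le hs hδ (hf.pow m) hf ht).trans
      (mul_le_mul_of_nonneg_right ih (taylorWeight_nonneg s n hδ f t))

theorem taylorWeight_id_le {s : Set ℝ} (hs : UniqueDiffOn ℝ s) {n : ℕ} {δ : ℝ} (hδ : 0 < δ)
    {t : ℝ} (ht : t ∈ s) :
    taylorWeight s n δ (fun x => x) t ≤ |t| + 1 / δ := by
  unfold taylorWeight
  have h : ∀ k, iteratedDerivWithin k (fun x : ℝ => x) s t =
      if k = 0 then t else if k = 1 then 1 else 0 := fun k =>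
    iteratedDerivWithin_id ht hs (n := k)
  have hp : 0 < 1 / δ := by positivity
  rcases n with _ | _ | n
  · simp; positivity
  · simp [h]; positivity
  · rw [Finset.sum_range_succ', Finset.sum_range_succ', Finset.sum_eq_zero]
    · simp [h]; linarith
    · intro k _
      simp [h]

theorem abs_iteratedDerivWithin_le_taylorWeight (s : Set ℝ) {n : ℕ} {δ : ℝ} (hδ : 0 < δ)
    (g : ℝ → ℝ) (t : ℝ) {k : ℕ} (hk : k < n) :
    |iteratedDerivWithin k g s t / (k.factorial : ℝ)| ≤ taylorWeight s n δ g t * δ ^ k := by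
  rw [← div_le_iff₀ (by positivity)]
  exact Finset.single_le_sum
    (f := fun k => |iteratedDerivWithin k g s t / (k.factorial : ℝ)| / δ ^ k)
    (fun _ _ => by positivity) (Finset.mem_range.mpr hk)

/-- Either a family of vectors lies on a hyperplane, or some square minor is non-singular. -/
theorem exists_dotProduct_eq_zero_or_exists_det_ne_zero {ι : Type*} {n : ℕ}
    (v : ι → Fin n → ℝ) :
    (∃ c : Fin n → ℝ, c ≠ 0 ∧ ∀ i, ∑ j, c j * v i j = 0) ∨
      ∃ a : Fin n → ι, Function.Injective a ∧ (Matrix.of fun i j => v (a i) j).det ≠ 0 := by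
  by_cases htop : Submodule.span ℝ (Set.range v) = ⊤
  · right
    obtain ⟨κ, a, ha, hspan, hli⟩ := exists_linearIndependent' ℝ v
    rw [htop] at hspan
    let B := Module.Basis.mk hli hspan.ge
    let e : κ ≃ Fin n := B.indexEquiv (Pi.basisFun ℝ (Fin n))
    refine ⟨a ∘ e.symm, ha.comp e.symm.injective, ?_⟩
    have h := hli.comp e.symm e.symm.injective
    have := (Matrix.linearIndependent_rows_iff_isUnit
      (A := Matrix.of fun i j => v ((a ∘ e.symm) i) j)).mp h
    exact ((Matrix.isUnit_iff_isUnit_det _).mp this).ne_zero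
  · left
    obtain ⟨φ, hφ, hker⟩ := Submodule.exists_le_ker_of_lt_top _ (lt_top_iff_ne_top.mpr htop)
    have hsum : ∀ w : Fin n → ℝ, φ w = ∑ j, φ (Pi.single j 1) * w j := fun w => by
      conv_lhs => rw [← Finset.univ_sum_single w]
      rw [map_sum]
      refine Finset.sum_congr rfl fun j _ => ?_
      have : (Pi.single j (w j) : Fin n → ℝ) = w j • Pi.single j 1 := by
        rw [← Pi.single_smul]; simp
      rw [this, map_smul, smul_eq_mul, mul_comm]
    refine ⟨fun j => φ (Pi.single j 1), fun h => hφ ?_, fun i => ?_⟩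
    · ext w
      have : ∀ j, φ (Pi.single j 1) = 0 := fun j => congrFun h j
      simp [this]
    · rw [← hsum]
      exact hker (Submodule.subset_span ⟨i, rfl⟩)

theorem factorial_le_two_pow_choose_two (n : ℕ) : n.factorial ≤ 2 ^ (n.choose 2) := by
  induction n with
  | zero => simp
  | succ n ih =>
    rw [Nat.factorial_succ, Nat.choose_succ_succ' n 1, Nat.choose_one_right, pow_add]
    exact Nat.mul_le_mul Nat.lt_two_pow_self ih

/-- Single-curve lemma: the integer points over a short subinterval lie on one curve. -/
theorem exists_curve_of_short_interval (M : Finset (ℕ × ℕ)) (D : ℕ) (hD : D = M.card)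
    (hD2 : 2 ≤ D) (p q : ℕ) (hp : p = ∑ j ∈ M, j.1) (hq : q = ∑ j ∈ M, j.2)
    (N : ℝ) (hN : 0 < N) (a b : ℝ) (hab : a < b) (ha : 0 ≤ a) (hb : b ≤ N)
    (f : ℝ → ℝ) (hf : ContDiffOn ℝ (D - 1 : ℕ) f (Icc a b))
    (X δ : ℝ) (hX : 0 < X) (hδ : 1 / N ≤ δ)
    (hbound : ∀ i < D, ∀ x ∈ Icc a b,
      |iteratedDerivWithin i f (Icc a b) x / (Nat.factorial i : ℝ)| ≤ X * δ ^ i)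
    (ℓ : ℝ) (hℓ0 : 0 ≤ ℓ)
    (hℓ : 4 * δ * ℓ *
      ((2 * N) ^ p * ((D : ℝ) * X) ^ q) ^ ((1 : ℝ) / (Nat.choose D 2 : ℝ)) ≤ 1) (u : ℝ) :
    ∃ c : ℕ × ℕ → ℝ, (∃ j ∈ M, c j ≠ 0) ∧
      ∀ x ∈ Icc a b, x ∈ Icc u (u + ℓ) → (∃ m : ℤ, x = (m : ℝ)) → (∃ k : ℤ, f x = (k : ℝ)) →
        ∑ j ∈ M, c j * x ^ j.1 * f x ^ j.2 = 0 := by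
  have hδ0 : 0 < δ := lt_of_lt_of_le (by positivity) hδ
  have hs := uniqueDiffOn_Icc hab
  have hD0 : (0 : ℝ) < D := by exact_mod_cast (by omega : 0 < D)
  set e : Fin D ≃ M := (M.equivFinOfCardEq hD.symm).symm
  let ι := {x : ℝ // x ∈ Icc a b ∧ x ∈ Icc u (u + ℓ) ∧ (∃ m : ℤ, x = (m : ℝ)) ∧
    ∃ k : ℤ, f x = (k : ℝ)}
  set g : Fin D → ℝ → ℝ := fun j => (fun x => x) ^ (e j).1.1 * f ^ (e j).1.2 with hg
  have hgapp : ∀ j x, g j x = x ^ (e j).1.1 * f x ^ (e j).1.2 := fun j x => rfl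
  have hsumM : ∀ F : ℕ × ℕ → ℝ, ∑ j, F (e j) = ∑ j ∈ M, F j := fun F => by
    rw [Equiv.sum_comp e (fun j : M => F j), Finset.sum_coe_sort M F]
  rcases exists_dotProduct_eq_zero_or_exists_det_ne_zero
    (fun (i : ι) (j : Fin D) => g j i.1) with ⟨c, hc, hcv⟩ | ⟨w, hw, hdet⟩
  · refine ⟨fun j => if h : j ∈ M then c (e.symm ⟨j, h⟩) else 0, ?_, ?_⟩
    · obtain ⟨j, hj⟩ := Function.ne_iff.mp hc
      exact ⟨e j, (e j).2, by simpa using hj⟩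
    · intro x hx hxu hm hk
      rw [← hsumM, ← hcv ⟨x, hx, hxu, hm, hk⟩]
      refine Finset.sum_congr rfl fun j _ => ?_
      simp [hgapp, mul_assoc]
  · exfalso
    have hfw : ∀ t ∈ Icc a b, taylorWeight (Icc a b) D δ f t ≤ D * X := by
      intro t ht
      unfold taylorWeight
      refine (Finset.sum_le_card_nsmul _ _ X fun k hk => ?_).trans (by simp)
      rw [div_le_iff₀ (by positivity)]
      exact hbound k (Finset.mem_range.mp hk) t ht
    have hxw : ∀ t ∈ Icc a b, taylorWeight (Icc a b) D δ (fun x => x) t ≤ 2 * N := by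
      intro t ht
      refine (taylorWeight_id_le hs hδ0 ht).trans ?_
      have h1 : |t| ≤ N := by
        rw [abs_of_nonneg (ha.trans ht.1)]; exact ht.2.trans hb
      have h2 : 1 / δ ≤ N := (one_div_le hN hδ0).mp hδ
      linarith
    have hid : ContDiffOn ℝ (D - 1 : ℕ) (fun x : ℝ => x) (Icc a b) := contDiffOn_id
    have hgb : ∀ j, ∀ k < D, ∀ t ∈ Icc a b,
        |iteratedDerivWithin k (g j) (Icc a b) t / (k.factorial : ℝ)| ≤
          ((2 * N) ^ (e j).1.1 * (D * X) ^ (e j).1.2) * δ ^ k := by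
      intro j k hk t ht
      refine (abs_iteratedDerivWithin_le_taylorWeight _ hδ0 _ t hk).trans ?_
      refine mul_le_mul_of_nonneg_right ?_ (by positivity)
      refine (taylorWeight_mul_le hs hδ0 (hid.pow _) (hf.pow _) ht).trans ?_
      refine mul_le_mul ?_ ?_ (taylorWeight_nonneg _ _ hδ0 _ _) (by positivity)
      · exact (taylorWeight_pow_le hs hδ0 hid ht _).trans
          (pow_le_pow_left₀ (taylorWeight_nonneg _ _ hδ0 _ _) (hxw t ht) _)
      · exact (taylorWeight_pow_le hs hδ0 hf ht _).trans
          (pow_le_pow_left₀ (taylorWeight_nonneg _ _ hδ0 _ _) (hfw t ht) _)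
    have hle := abs_det_le_of_iteratedDerivWithin_le hab (fun i => (w i).1)
      (Subtype.val_injective.comp hw) (fun i => (w i).2.1) ℓ
      (fun i j => by
        have hi := (w i).2.2.1
        have hj := (w j).2.2.1
        rw [abs_le]
        constructor <;> linarith [hi.1, hi.2, hj.1, hj.2])
      g (fun j => (hid.pow _).mul (hf.pow _)) _ δ hgb
    have hprod : ∏ j, ((2 * N) ^ (e j).1.1 * (D * X) ^ (e j).1.2) =
        (2 * N) ^ p * ((D : ℝ) * X) ^ q := by
      rw [Equiv.prod_comp e (fun j : M => (2 * N) ^ j.1.1 * (D * X) ^ j.1.2),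
        Finset.prod_coe_sort M (fun j => (2 * N) ^ j.1 * (D * X) ^ j.2),
        Finset.prod_mul_distrib, Finset.prod_pow_eq_pow_sum, Finset.prod_pow_eq_pow_sum, hp, hq]
    rw [hprod] at hle
    set K : ℝ := (2 * N) ^ p * ((D : ℝ) * X) ^ q with hK
    have hK0 : 0 < K := by positivity
    set B : ℕ := D.choose 2 with hB
    have hB0 : B ≠ 0 := (Nat.choose_pos hD2).ne'
    set κ : ℝ := K ^ ((1 : ℝ) / (B : ℝ)) with hκ
    have hκ0 : 0 < κ := Real.rpow_pos_of_pos hK0 _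
    have hκB : κ ^ B = K := by
      rw [hκ, one_div]
      exact Real.rpow_inv_natCast_pow hK0.le hB0
    have hlt : |(Matrix.of fun i j => g j (w i).1).det| < 1 := by
      refine hle.trans_lt ?_
      calc (D.factorial : ℝ) * (δ * ℓ) ^ B * K ≤ 2 ^ B * (δ * ℓ) ^ B * κ ^ B := by
            rw [hκB]
            gcongr
            exact_mod_cast factorial_le_two_pow_choose_two D
        _ = (2 * (δ * ℓ) * κ) ^ B := by rw [← mul_pow, ← mul_pow]
        _ ≤ (1 / 2) ^ B := by
            refine pow_le_pow_left₀ (by positivity) ?_ _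
            linarith
        _ < 1 := pow_lt_one₀ (by norm_num) (by norm_num) hB0
    choose m hm using fun i => (w i).2.2.2.1
    choose k hk using fun i => (w i).2.2.2.2
    have hint : (Matrix.of fun i j => g j (w i).1).det =
        (((Matrix.of fun i j => m i ^ (e j).1.1 * k i ^ (e j).1.2).det : ℤ) : ℝ) := by
      rw [Int.cast_det]
      congr 1
      ext i j
      simp [hgapp, hk i, ← hm i]
    rw [hint] at hlt
    have h0 := Int.abs_lt_one_iff.mp (by exact_mod_cast hlt)
    apply hdet
    rw [hint, h0, Int.cast_zero]

/-- Bombieri–Pila covering lemma: the integer points on the graph are covered by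
at most `4 δ |I| ((2N)^p (DX)^q)^{1/binom(D,2)} + 1` curves supported on `M`. -/
theorem stmt_19 (M : Finset (ℕ × ℕ)) (D : ℕ) (hD : D = M.card) (hD2 : 2 ≤ D)
    (p q : ℕ) (hp : p = ∑ j ∈ M, j.1) (hq : q = ∑ j ∈ M, j.2)
    (N : ℝ) (hN : 0 < N) (a b : ℝ) (hab : a < b) (ha : 0 ≤ a) (hb : b ≤ N)
    (f : ℝ → ℝ) (hf : ContDiffOn ℝ (D - 1 : ℕ) f (Icc a b))
    (X δ : ℝ) (hX : 0 < X) (hδ : 1 / N ≤ δ)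
    (hbound : ∀ i < D, ∀ x ∈ Icc a b,
      |iteratedDerivWithin i f (Icc a b) x / (Nat.factorial i : ℝ)| ≤ X * δ ^ i) :
    ∃ (n : ℕ) (cs : Fin n → (ℕ × ℕ → ℝ)),
      (n : ℝ) ≤
        4 * δ * (b - a) *
          ((2 * N) ^ p * ((D : ℝ) * X) ^ q) ^ ((1 : ℝ) / (Nat.choose D 2 : ℝ)) + 1 ∧
      (∀ v : Fin n, ∃ j ∈ M, cs v j ≠ 0) ∧
      ∀ x ∈ Icc a b, (∃ m : ℤ, x = (m : ℝ)) → (∃ k : ℤ, f x = (k : ℝ)) →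
        ∃ v : Fin n, ∑ j ∈ M, cs v j * x ^ j.1 * f x ^ j.2 = 0 := by
  have hδ0 : 0 < δ := lt_of_lt_of_le (by positivity) hδ
  have hD0 : (0 : ℝ) < D := by exact_mod_cast (by omega : 0 < D)
  have hcurve := exists_curve_of_short_interval M D hD hD2 p q hp hq N hN a b hab ha hb f hf X δ
    hX hδ hbound
  set κ : ℝ := ((2 * N) ^ p * ((D : ℝ) * X) ^ q) ^ ((1 : ℝ) / (Nat.choose D 2 : ℝ)) with hκ
  have hκ0 : 0 < κ := Real.rpow_pos_of_pos (by positivity) _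
  set ℓ : ℝ := 1 / (4 * δ * κ) with hℓ
  have hℓ0 : 0 < ℓ := by positivity
  have hdiv : ∀ y : ℝ, 4 * δ * y * κ = y / ℓ := fun y => by rw [hℓ]; field_simp
  choose c hc0 hc using hcurve ℓ hℓ0.le (by rw [hdiv, div_self hℓ0.ne'])
  have hpos : 0 < (b - a) / ℓ := div_pos (sub_pos.mpr hab) hℓ0
  refine ⟨⌈(b - a) / ℓ⌉₊, fun v => c (a + v * ℓ), ?_, fun v => hc0 _, fun x hx hm hk => ?_⟩
  · rw [hdiv]
    exact (Nat.ceil_lt_add_one hpos.le).le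
  · have hceil : 0 < ⌈(b - a) / ℓ⌉₊ := Nat.ceil_pos.mpr hpos
    have hxle : ⌈(x - a) / ℓ⌉₊ ≤ ⌈(b - a) / ℓ⌉₊ :=
      Nat.ceil_mono (div_le_div_of_nonneg_right (by linarith [hx.2]) hℓ0.le)
    refine ⟨⟨⌈(x - a) / ℓ⌉₊ - 1, by omega⟩, hc _ x hx ?_ hm hk⟩
    have h1 : (x - a) / ℓ ≤ ⌈(x - a) / ℓ⌉₊ := Nat.le_ceil _
    have h2 := Nat.ceil_lt_add_one (div_nonneg (sub_nonneg.mpr hx.1) hℓ0.le)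
    have hxa : (x - a) / ℓ * ℓ = x - a := div_mul_cancel₀ _ hℓ0.ne'
    rcases Nat.eq_zero_or_pos ⌈(x - a) / ℓ⌉₊ with h | h
    · simp only [h, Nat.zero_sub]
      rw [h] at h1
      have : (x - a) / ℓ * ℓ ≤ 0 := mul_nonpos_of_nonpos_of_nonneg (by simpa using h1) hℓ0.le
      constructor
      · simpa using hx.1
      · simp; linarith
    · have hcast : ((⌈(x - a) / ℓ⌉₊ - 1 : ℕ) : ℝ) = ⌈(x - a) / ℓ⌉₊ - 1 := by
        rw [Nat.cast_sub h, Nat.cast_one]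
      simp only [hcast]
      have h1' := mul_le_mul_of_nonneg_right h1 hℓ0.le
      have h2' := mul_le_mul_of_nonneg_right h2.le hℓ0.le
      constructor <;> nlinarith
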